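/- Let ω = (−1 + i√3)/2 and let Q be an n×n nontrivial cube root Seidel matrix in standard form satisfying Q² = (n−1)·I + μ·Q for a real number μ. Then μ is an integer m with m ≡ 1 (mod 3) satisfying 1 − n/3 ≤ m ≤ n/3 − 2 (equivalently, 3 − n ≤ 3m and 3m ≤ n − 6). -/

import Mathlib

/-- `ω = (−1 + i√3)/2`, a primitive cube root of unity. -/
noncomputable def ω3 : ℂ := (-1 + Complex.I * Real.sqrt 3) / 2

/-- A cube root Seidel matrix: self-adjoint, zero diagonal, off-diagonal
entries among the cube roots of unity. -/
def IsCubeRootSeidel {n : ℕ} (Q : Matrix (Fin n) (Fin n) ℂ) : Prop :=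
  Q.IsHermitian ∧ (∀ i, Q i i = 0) ∧
    ∀ i j, i ≠ j → Q i j = 1 ∨ Q i j = ω3 ∨ Q i j = ω3 ^ 2

/-- Standard form: every off-diagonal entry in the first row and first column
equals 1. -/
def IsStandardForm {n : ℕ} (Q : Matrix (Fin n) (Fin n) ℂ) : Prop :=
  ∀ i j : Fin n, i ≠ j → (i.val = 0 ∨ j.val = 0) → Q i j = 1

/-- Nontrivial: some off-diagonal entry is not equal to 1. -/
def IsNontrivial {n : ℕ} (Q : Matrix (Fin n) (Fin n) ℂ) : Prop :=
  ∃ i j : Fin n, i ≠ j ∧ Q i j ≠ 1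

lemma ω3_re : ω3.re = -1 / 2 := by simp [ω3]

lemma ω3_im : ω3.im = Real.sqrt 3 / 2 := by simp [ω3]

lemma ω3_sq : ω3 ^ 2 = -1 - ω3 := by
  have h3 : ((Real.sqrt 3 : ℝ) : ℂ) ^ 2 = 3 := by
    rw [← Complex.ofReal_pow, Real.sq_sqrt (by norm_num)]; norm_num
  unfold ω3
  linear_combination (1 / 4 * ((Real.sqrt 3 : ℝ) : ℂ) ^ 2) * Complex.I_sq - 1 / 4 * h3

lemma ω3_cube : ω3 ^ 3 = 1 := by
  linear_combination (ω3 - 1) * ω3_sq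

lemma ω3_ne_one : ω3 ≠ 1 := by
  intro h
  have := congrArg Complex.re h
  rw [ω3_re] at this
  norm_num at this

lemma star_ω3_sq : star (ω3 ^ 2) = ω3 := by
  rw [ω3_sq]
  apply Complex.ext
  · simp [ω3_re]; norm_num
  · simp

/-- An integer combination of the cube roots of unity which is real is an integer. -/
lemma eq_of_add_mul_ω3_eq_ofReal {a b c : ℤ} {μ : ℝ}
    (h : (a : ℂ) + b * ω3 + c * ω3 ^ 2 = μ) : b = c ∧ μ = ((a - b : ℤ) : ℝ) := by
  rw [ω3_sq] at h
  have hre := congrArg Complex.re h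
  have him := congrArg Complex.im h
  simp [ω3_re, ω3_im] at hre him
  have hbc : (b : ℝ) = c := by
    have h3 : Real.sqrt 3 ≠ 0 := by positivity
    have : ((b : ℝ) - c) * Real.sqrt 3 = 0 := by linarith
    rcases mul_eq_zero.1 this with h | h
    · linarith
    · exact absurd h h3
  refine ⟨by exact_mod_cast hbc, ?_⟩
  push_cast
  rw [← hbc] at hre
  linarith

lemma sum_comp_eq_sum_card_smul {ι κ M : Type*} [Fintype κ] [DecidableEq κ] [AddCommMonoid M]
    (s : Finset ι) (g : ι → κ) (F : κ → M) :
    ∑ k ∈ s, F (g k) = ∑ p, (s.filter (g · = p)).card • F p := by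
  rw [← Finset.sum_fiberwise' s g F]
  simp

/-- The congruence and the bounds for `μ`, from the sums over all but three indices of a row, of a
column and of their product. Each index `k` carries the pair `g k` of exponents of `ω3`. -/
lemma mu_bounds_of_sums {ι : Type*} (T : Finset ι) (g : ι → Fin 3 × Fin 3) (μ : ℝ)
    (hx : ∑ k ∈ T, ω3 ^ (g k).1.val = μ - ω3) (hy : ∑ k ∈ T, ω3 ^ (g k).2.val = μ - ω3)
    (hxy : ∑ k ∈ T, ω3 ^ (g k).1.val * ω3 ^ (g k).2.val = μ * ω3 - 1) :
    ∃ m : ℤ, μ = (m : ℝ) ∧ m % 3 = 1 ∧ 3 - ((T.card : ℤ) + 3) ≤ 3 * m ∧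
      3 * m ≤ ((T.card : ℤ) + 3) - 6 := by
  have hcard := sum_comp_eq_sum_card_smul T g (fun _ => (1 : ℕ))
  rw [sum_comp_eq_sum_card_smul T g (fun p => ω3 ^ p.1.val)] at hx
  rw [sum_comp_eq_sum_card_smul T g (fun p => ω3 ^ p.2.val)] at hy
  rw [sum_comp_eq_sum_card_smul T g (fun p => ω3 ^ p.1.val * ω3 ^ p.2.val)] at hxy
  generalize hN : (fun p => (T.filter (g · = p)).card) = N at *
  have hN' (p) : (T.filter (g · = p)).card = N p := congrFun hN p
  simp only [hN', Fintype.sum_prod_type, Fin.sum_univ_three, nsmul_eq_mul, Fin.val_zero,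
    Fin.val_one, Fin.val_two, pow_zero, pow_one, Finset.sum_const, mul_one, one_mul,
    smul_eq_mul] at hcard hx hy hxy
  generalize N (0, 0) = a at *
  generalize N (0, 1) = b at *
  generalize N (0, 2) = c at *
  generalize N (1, 0) = d at *
  generalize N (1, 1) = e at *
  generalize N (1, 2) = f at *
  generalize N (2, 0) = p at *
  generalize N (2, 1) = q at *
  generalize N (2, 2) = r at *
  obtain ⟨hx₁, hx₂⟩ := eq_of_add_mul_ω3_eq_ofReal (a := a + b + c) (b := d + e + f + 1)
    (c := p + q + r) (μ := μ) (by push_cast; linear_combination hx)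
  obtain ⟨hy₁, hy₂⟩ := eq_of_add_mul_ω3_eq_ofReal (a := a + d + p) (b := b + e + q + 1)
    (c := c + f + r) (μ := μ) (by push_cast; linear_combination hy)
  obtain ⟨hz₁, hz₂⟩ := eq_of_add_mul_ω3_eq_ofReal (a := b + d + r) (b := c + e + p)
    (c := a + f + q + 1) (μ := μ) (by
      push_cast
      linear_combination ω3 ^ 2 * hxy +
        (μ - (b + d) - (c + e + p) * ω3 - (f + q) * ω3 ^ 2 - r * (ω3 ^ 3 + 1)) * ω3_cube)
  rw [hx₂] at hy₂ hz₂
  have hy₃ := Int.cast_injective hy₂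
  have hz₃ := Int.cast_injective hz₂
  refine ⟨_, hx₂, ?_, ?_, ?_⟩ <;> omega

lemma IsCubeRootSeidel.exists_exponent {n : ℕ} {Q : Matrix (Fin n) (Fin n) ℂ}
    (hQ : IsCubeRootSeidel Q) :
    ∃ e : Fin n → Fin n → Fin 3, ∀ i j, i ≠ j → Q i j = ω3 ^ (e i j).val := by
  have this (i j) : ∃ s : Fin 3, i ≠ j → Q i j = ω3 ^ s.val := by
    by_cases hij : i = j
    · exact ⟨0, fun h => absurd hij h⟩
    · rcases hQ.2.2 i j hij with h | h | h
      · exact ⟨0, fun _ => by simpa using h⟩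
      · exact ⟨1, fun _ => by simpa using h⟩
      · exact ⟨2, fun _ => by simpa using h⟩
  choose e he using this
  exact ⟨e, he⟩

lemma IsCubeRootSeidel.exists_eq_ω3 {n : ℕ} {Q : Matrix (Fin n) (Fin n) ℂ}
    (hQ : IsCubeRootSeidel Q) (hnt : IsNontrivial Q) : ∃ i j, i ≠ j ∧ Q i j = ω3 := by
  obtain ⟨i, j, hij, h1⟩ := hnt
  rcases hQ.2.2 i j hij with h | h | h
  · exact absurd h h1
  · exact ⟨i, j, hij, h⟩
  · exact ⟨j, i, hij.symm, by rw [← hQ.1.apply, h, star_ω3_sq]⟩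

theorem cubeRootSeidel_mu_bounds
    (n : ℕ) (Q : Matrix (Fin n) (Fin n) ℂ) (μ : ℝ)
    (hQ : IsCubeRootSeidel Q) (hsf : IsStandardForm Q) (hnt : IsNontrivial Q)
    (heq : Q ^ 2 = ((n : ℂ) - 1) • (1 : Matrix (Fin n) (Fin n) ℂ) + (μ : ℂ) • Q) :
    ∃ m : ℤ, μ = (m : ℝ) ∧ m % 3 = 1 ∧
      3 - (n : ℤ) ≤ 3 * m ∧ 3 * m ≤ (n : ℤ) - 6 := by
  obtain ⟨i, j, hij, hω⟩ := hQ.exists_eq_ω3 hnt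
  obtain ⟨e, he⟩ := hQ.exists_exponent
  obtain ⟨z, hz⟩ : ∃ z : Fin n, z.val = 0 := ⟨⟨0, i.pos⟩, rfl⟩
  have hiz : i ≠ z := by
    rintro rfl
    exact ω3_ne_one (hω ▸ hsf _ _ hij (Or.inl hz))
  have hjz : j ≠ z := by
    rintro rfl
    exact ω3_ne_one (hω ▸ hsf _ _ hij (Or.inr hz))
  have hentry (k l : Fin n) (hkl : k ≠ l) : ∑ r, Q k r * Q r l = μ * Q k l := by
    have := congrFun (congrFun heq k) l
    simpa [pow_two, Matrix.mul_apply, hkl] using this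
  set T := ((Finset.univ.erase z).erase i).erase j with hT
  have hi : i ∈ Finset.univ.erase z := by simp [hiz]
  have hj : j ∈ (Finset.univ.erase z).erase i := by simp [hjz, hij.symm]
  have hsum (f : Fin n → ℂ) : ∑ k, f k = f z + (f i + (f j + ∑ k ∈ T, f k)) := by
    rw [Finset.add_sum_erase _ _ hj, Finset.add_sum_erase _ _ hi,
      Finset.add_sum_erase _ _ (Finset.mem_univ z)]
  have hmem (k) (hk : k ∈ T) : k ≠ j ∧ k ≠ i ∧ k ≠ z := by simpa [hT] using hk
  have hcard : (T.card : ℤ) + 3 = n := by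
    have h₁ := Finset.card_erase_add_one hj
    have h₂ := Finset.card_erase_add_one hi
    have h₃ := Finset.card_erase_add_one (Finset.mem_univ z)
    rw [Finset.card_univ, Fintype.card_fin] at h₃
    rw [← hT] at h₁
    omega
  have hzl (k) (hk : k ≠ z) : Q z k = 1 := hsf _ _ hk.symm (Or.inl hz)
  have hzr (k) (hk : k ≠ z) : Q k z = 1 := hsf _ _ hk (Or.inr hz)
  have hrow := hentry i z hiz
  have hcol := hentry z j hjz.symm
  have hprod := hentry i j hij
  rw [hsum] at hrow hcol hprod
  simp only [hQ.2.1, hω, hzl _ hiz, hzl _ hjz, hzr _ hiz, hzr _ hjz] at hrow hcol hprod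
  rw [← hcard]
  refine mu_bounds_of_sums T (fun k => (e i k, e k j)) μ ?_ ?_ ?_
  · rw [Finset.sum_congr rfl fun k hk => show _ = Q i k * Q k z by
      rw [hzr k (hmem k hk).2.2, mul_one, he i k (hmem k hk).2.1.symm]]
    linear_combination hrow
  · rw [Finset.sum_congr rfl fun k hk => show _ = Q z k * Q k j by
      rw [hzl k (hmem k hk).2.2, one_mul, he k j (hmem k hk).1]]
    linear_combination hcol
  · rw [Finset.sum_congr rfl fun k hk => show _ = Q i k * Q k j by
      rw [he i k (hmem k hk).2.1.symm, he k j (hmem k hk).1]]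
    linear_combination hprod
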